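/- Let m ≥ 2, let y ∈ Δ^{m−1}, and let Y ∈ ℝ^{m×m!} be the matrix whose columns are the m! permutations g_j ∘ y of y under an enumeration {g_1,…,g_{m!}} of the symmetric group S_m. Fix E_W, E_H > 0. Then for every pair (W, H) with W ∈ ℝ^{m×d}, H ∈ ℝ^{d×m!}, ‖W‖_F² ≤ E_W and ‖H‖_F² ≤ E_H, and for every α ∈ Δ^{m−1} with all coordinates strictly positive, the layer-peeled objective satisfies the lower bound J(W,H;Y) ≥ −√(m!·E_W·E_H/(m−1)) · ‖α − y‖₂ − m!·Σ_{i=1}^m α_i log α_i. -/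

import Mathlib

open scoped BigOperators
open Matrix

/-- Softmax function: `σ(z)_i = exp(z_i) / ∑_k exp(z_k)`. -/
noncomputable def softmax {m : ℕ} (u : Fin m → ℝ) : Fin m → ℝ :=
  fun i => Real.exp (u i) / ∑ k, Real.exp (u k)

/-- Cross-entropy loss `L(q, p) = −∑ᵢ pᵢ log qᵢ`. -/
noncomputable def crossEnt {m : ℕ} (q p : Fin m → ℝ) : ℝ :=
  -∑ i, p i * Real.log (q i)

/-- Squared Frobenius norm `‖A‖_F²`. -/
noncomputable def frobSq {m n : Type*} [Fintype m] [Fintype n] (A : Matrix m n ℝ) : ℝ :=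
  ∑ i, ∑ j, (A i j) ^ 2

/-- The layer-peeled objective `J(W,H;Y) = ∑ⱼ L(σ((WH)_{:,j}), Y_{:,j})`. -/
noncomputable def lpObj {m d : ℕ} {n : Type*} [Fintype n]
    (W : Matrix (Fin m) (Fin d) ℝ) (H : Matrix (Fin d) n ℝ) (Y : Matrix (Fin m) n ℝ) : ℝ :=
  ∑ j, crossEnt (softmax (fun i => (W * H) i j)) (fun i => Y i j)

/-- `(W, H)` is a global minimizer of the constrained layer-peeled problem
`min J(W,H;Y)` subject to `‖W‖_F² ≤ E_W` and `‖H‖_F² ≤ E_H`. -/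
def IsGlobalMin {m d : ℕ} {n : Type*} [Fintype n] (EW EH : ℝ) (Y : Matrix (Fin m) n ℝ)
    (W : Matrix (Fin m) (Fin d) ℝ) (H : Matrix (Fin d) n ℝ) : Prop :=
  frobSq W ≤ EW ∧ frobSq H ≤ EH ∧
  ∀ (W' : Matrix (Fin m) (Fin d) ℝ) (H' : Matrix (Fin d) n ℝ),
    frobSq W' ≤ EW → frobSq H' ≤ EH → lpObj W H Y ≤ lpObj W' H' Y

/-- The real permutation matrix `ρ(g)` of a permutation `g`, acting on coordinates. -/
def permMat {m : ℕ} (g : Equiv.Perm (Fin m)) : Matrix (Fin m) (Fin m) ℝ :=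
  Matrix.of fun i j => if i = g j then 1 else 0

/-- Gibbs' variational inequality for log-sum-exp. -/
theorem sum_mul_sub_log_le_log_sum_exp {ι : Type*} [Fintype ι] {a : ι → ℝ}
    (ha : ∀ i, 0 < a i) (ha1 : ∑ i, a i = 1) (u : ι → ℝ) :
    ∑ i, a i * (u i - Real.log (a i)) ≤ Real.log (∑ i, Real.exp (u i)) := by
  have h := strictConcaveOn_log_Ioi.concaveOn.le_map_sum (t := Finset.univ) (w := a)
    (p := fun i => Real.exp (u i) / a i) (fun i _ => (ha i).le) ha1
    (fun i _ => div_pos (Real.exp_pos _) (ha i))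
  simp only [smul_eq_mul] at h
  have hlog : ∀ i, Real.log (Real.exp (u i) / a i) = u i - Real.log (a i) := fun i => by
    rw [Real.log_div (Real.exp_pos _).ne' (ha i).ne', Real.log_exp]
  have hexp : ∀ i, a i * (Real.exp (u i) / a i) = Real.exp (u i) := fun i =>
    mul_div_cancel₀ _ (ha i).ne'
  simpa only [hlog, hexp] using h

theorem crossEnt_softmax {m : ℕ} [NeZero m] (u p : Fin m → ℝ) (hp : ∑ i, p i = 1) :
    crossEnt (softmax u) p = Real.log (∑ k, Real.exp (u k)) - ∑ i, p i * u i := by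
  have hS : 0 < ∑ k, Real.exp (u k) :=
    Finset.sum_pos (fun i _ => Real.exp_pos _) Finset.univ_nonempty
  have h : ∀ i, p i * Real.log (softmax u i)
      = p i * u i - p i * Real.log (∑ k, Real.exp (u k)) := fun i => by
    rw [softmax, Real.log_div (Real.exp_pos _).ne' hS.ne', Real.log_exp, mul_sub]
  simp only [crossEnt, h, Finset.sum_sub_distrib, ← Finset.sum_mul, hp]
  ring

/-- Cross-entropy against `p` is bounded below by the tangent of log-sum-exp determined by `a`. -/
theorem le_crossEnt_softmax {m : ℕ} [NeZero m] {a p : Fin m → ℝ} (ha : ∀ i, 0 < a i)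
    (ha1 : ∑ i, a i = 1) (hp : ∑ i, p i = 1) (u : Fin m → ℝ) :
    ∑ i, u i * (a i - p i) - ∑ i, a i * Real.log (a i) ≤ crossEnt (softmax u) p := by
  rw [crossEnt_softmax u p hp]
  have h := sum_mul_sub_log_le_log_sum_exp ha ha1 u
  simp only [mul_sub, Finset.sum_sub_distrib] at h ⊢
  simp only [mul_comm (u _)]
  linarith

section PermMoments

variable {ι : Type*} [Fintype ι] [DecidableEq ι]

theorem sum_perm_mul_apply (b : ι → ℝ) (τ : Equiv.Perm ι) (i j : ι) :
    ∑ g : Equiv.Perm ι, b (g (τ i)) * b (g (τ j)) = ∑ g : Equiv.Perm ι, b (g i) * b (g j) :=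
  Equiv.sum_comp (Equiv.mulRight τ) fun g : Equiv.Perm ι => b (g i) * b (g j)

theorem card_mul_sum_perm_mul_self (b : ι → ℝ) (i : ι) :
    (Fintype.card ι : ℝ) * ∑ g : Equiv.Perm ι, b (g i) * b (g i)
      = (Fintype.card ι).factorial * ∑ k, b k ^ 2 := by
  have h : ∀ j, ∑ g : Equiv.Perm ι, b (g j) * b (g j)
      = ∑ g : Equiv.Perm ι, b (g i) * b (g i) := fun j => by
    simpa using sum_perm_mul_apply b (Equiv.swap i j) i i
  have h1 : ∑ j, ∑ g : Equiv.Perm ι, b (g j) * b (g j)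
      = (Fintype.card ι : ℝ) * ∑ g : Equiv.Perm ι, b (g i) * b (g i) := by
    simp [h]
  rw [← h1, Finset.sum_comm]
  have h2 : ∀ g : Equiv.Perm ι, ∑ j, b (g j) * b (g j) = ∑ k, b k ^ 2 := fun g => by
    simpa only [sq] using Equiv.sum_comp g fun k => b k * b k
  simp [h2, Fintype.card_perm]

theorem card_sub_one_mul_sum_perm_mul {b : ι → ℝ} (hb : ∑ k, b k = 0) {i j : ι} (hij : j ≠ i) :
    ((Fintype.card ι : ℝ) - 1) * ∑ g : Equiv.Perm ι, b (g i) * b (g j)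
      = -∑ g : Equiv.Perm ι, b (g i) * b (g i) := by
  have h : ∀ k ∈ Finset.univ.erase i, ∑ g : Equiv.Perm ι, b (g i) * b (g k)
      = ∑ g : Equiv.Perm ι, b (g i) * b (g j) := fun k hk => by
    have hk : k ≠ i := Finset.ne_of_mem_erase hk
    simpa [Equiv.swap_apply_of_ne_of_ne hij.symm hk.symm] using
      sum_perm_mul_apply b (Equiv.swap j k) i j
  have h0 : ∑ k, ∑ g : Equiv.Perm ι, b (g i) * b (g k) = 0 := by
    rw [Finset.sum_comm]
    refine Finset.sum_eq_zero fun g _ => ?_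
    rw [← Finset.mul_sum, Equiv.sum_comp g b, hb, mul_zero]
  rw [← Finset.add_sum_erase _ _ (Finset.mem_univ i), Finset.sum_congr rfl h] at h0
  have hc : 1 ≤ Fintype.card ι := Fintype.card_pos_iff.2 ⟨i⟩
  simp only [Finset.sum_const, Finset.card_erase_of_mem (Finset.mem_univ i), Finset.card_univ,
    nsmul_eq_mul, Nat.cast_sub hc, Nat.cast_one] at h0
  linarith

/-- The permutations of a mean-zero vector form a frame with upper bound
`m! / (m - 1) * ‖b‖²`. -/
theorem sum_perm_sq_le (hm : 2 ≤ Fintype.card ι) {b : ι → ℝ} (hb : ∑ k, b k = 0) (w : ι → ℝ) :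
    ∑ g : Equiv.Perm ι, (∑ i, w i * b (g i)) ^ 2
      ≤ (Fintype.card ι).factorial / ((Fintype.card ι : ℝ) - 1) * (∑ k, b k ^ 2)
        * ∑ i, w i ^ 2 := by
  have hm' : (2 : ℝ) ≤ Fintype.card ι := by exact_mod_cast hm
  set n : ℝ := (Fintype.card ι : ℝ) with hn
  set F : ℝ := ((Fintype.card ι).factorial : ℝ) * ∑ k, b k ^ 2 with hF
  have hn1 : n - 1 ≠ 0 := by linarith
  have hn0 : n ≠ 0 := by linarith
  have hF0 : 0 ≤ F := by positivity
  have hM : ∀ i j, ∑ g : Equiv.Perm ι, b (g i) * b (g j)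
      = (if i = j then F / (n - 1) else 0) - F / (n * (n - 1)) := fun i j => by
    have hD : ∑ g : Equiv.Perm ι, b (g i) * b (g i) = F / n := by
      rw [eq_div_iff hn0, mul_comm]
      exact card_mul_sum_perm_mul_self b i
    split_ifs with h
    · subst h
      rw [hD]
      field_simp
    · have hE := card_sub_one_mul_sum_perm_mul hb (Ne.symm h)
      rw [hD, ← hn] at hE
      rw [← mul_right_inj' hn1, hE]
      field_simp
      ring
  have hexp : ∑ g : Equiv.Perm ι, (∑ i, w i * b (g i)) ^ 2
      = ∑ i, ∑ j, w i * w j * ∑ g : Equiv.Perm ι, b (g i) * b (g j) := by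
    have hsq : ∀ g : Equiv.Perm ι, (∑ i, w i * b (g i)) ^ 2
        = ∑ i, ∑ j, w i * b (g i) * (w j * b (g j)) := fun g => by
      rw [sq, Finset.sum_mul_sum]
    simp only [hsq, Finset.mul_sum]
    rw [Finset.sum_comm]
    refine Finset.sum_congr rfl fun i _ => ?_
    rw [Finset.sum_comm]
    exact Finset.sum_congr rfl fun j _ => Finset.sum_congr rfl fun g _ => by ring
  have hval : ∑ i, ∑ j, w i * w j * ∑ g : Equiv.Perm ι, b (g i) * b (g j)
      = F / (n - 1) * ∑ i, w i ^ 2 - F / (n * (n - 1)) * (∑ i, w i) ^ 2 := by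
    simp only [hM, mul_sub (w _ * w _), Finset.sum_sub_distrib, mul_ite, mul_zero,
      Finset.sum_ite_eq, Finset.mem_univ, if_true, ← Finset.sum_mul]
    rw [sq (∑ i, w i), Finset.sum_mul_sum, mul_comm (F / (n - 1)),
      mul_comm (F / (n * (n - 1)))]
    simp only [sq]
  have hpos : 0 ≤ F / (n * (n - 1)) * (∑ i, w i) ^ 2 :=
    mul_nonneg (div_nonneg hF0 (mul_nonneg (by linarith) (by linarith))) (sq_nonneg _)
  rw [hexp, hval, div_mul_eq_mul_div _ _ (∑ k, b k ^ 2), ← hF]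
  linarith

end PermMoments

theorem abs_sum_mul_perm_le {m d : ℕ} (hm : 2 ≤ m) (W : Matrix (Fin m) (Fin d) ℝ)
    (H : Matrix (Fin d) (Equiv.Perm (Fin m)) ℝ) {b : Fin m → ℝ} (hb : ∑ k, b k = 0) :
    |∑ g : Equiv.Perm (Fin m), ∑ i, (W * H) i g * b (g⁻¹ i)|
      ≤ √(m.factorial / ((m : ℝ) - 1) * (∑ k, b k ^ 2) * frobSq W * frobSq H) := by
  refine Real.abs_le_sqrt ?_
  have hrw : ∑ g : Equiv.Perm (Fin m), ∑ i, (W * H) i g * b (g⁻¹ i)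
      = ∑ p : Fin d × Equiv.Perm (Fin m), (∑ i, W i p.1 * b (p.2⁻¹ i)) * H p.1 p.2 := by
    rw [Fintype.sum_prod_type_right]
    refine Finset.sum_congr rfl fun g _ => ?_
    simp only [Matrix.mul_apply, Finset.sum_mul]
    rw [Finset.sum_comm]
    exact Finset.sum_congr rfl fun k _ => Finset.sum_congr rfl fun i _ => by ring
  have hH : ∑ p : Fin d × Equiv.Perm (Fin m), H p.1 p.2 ^ 2 = frobSq H := by
    rw [Fintype.sum_prod_type, frobSq]
  have hW : ∑ p : Fin d × Equiv.Perm (Fin m), (∑ i, W i p.1 * b (p.2⁻¹ i)) ^ 2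
      ≤ m.factorial / ((m : ℝ) - 1) * (∑ k, b k ^ 2) * frobSq W := by
    rw [Fintype.sum_prod_type, frobSq, Finset.sum_comm (f := fun i j => W i j ^ 2),
      Finset.mul_sum]
    refine Finset.sum_le_sum fun k _ => ?_
    refine (Equiv.sum_comp (Equiv.inv (Equiv.Perm (Fin m)))
      fun g : Equiv.Perm (Fin m) => (∑ i, W i k * b (g i)) ^ 2).trans_le ?_
    simpa using sum_perm_sq_le (by simpa using hm) hb fun i => W i k
  rw [hrw]
  refine (Finset.sum_mul_sq_le_sq_mul_sq _ _ _).trans ?_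
  rw [hH]
  exact mul_le_mul_of_nonneg_right hW
    (Finset.sum_nonneg fun _ _ => Finset.sum_nonneg fun _ _ => sq_nonneg _)

theorem permMat_mulVec {m : ℕ} (g : Equiv.Perm (Fin m)) (y : Fin m → ℝ) (i : Fin m) :
    (permMat g *ᵥ y) i = y (g⁻¹ i) := by
  simp [Matrix.mulVec, dotProduct, permMat, ← Equiv.Perm.inv_eq_iff_eq]

/-- Lower bound on the layer-peeled objective for the symmetric-group orbit target: for any
feasible `(W, H)` and any strictly positive `α` in the simplex,
`J(W,H;Y) ≥ −√(m!·E_W·E_H/(m−1))·‖α−y‖₂ − m!·∑ᵢ αᵢ log αᵢ`. -/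
theorem layer_peeled_lower_bound_symmetric_group
    (m d : ℕ) (hm : 2 ≤ m)
    (y : Fin m → ℝ) (hy : y ∈ stdSimplex ℝ (Fin m))
    (EW EH : ℝ) (hEW : 0 < EW) (hEH : 0 < EH)
    (Y : Matrix (Fin m) (Equiv.Perm (Fin m)) ℝ)
    (hY : ∀ g : Equiv.Perm (Fin m), (fun i => Y i g) = permMat g *ᵥ y)
    (W : Matrix (Fin m) (Fin d) ℝ) (H : Matrix (Fin d) (Equiv.Perm (Fin m)) ℝ)
    (hWf : frobSq W ≤ EW) (hHf : frobSq H ≤ EH)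
    (α : Fin m → ℝ) (hα : α ∈ stdSimplex ℝ (Fin m)) (hαpos : ∀ i, 0 < α i) :
    -(Real.sqrt ((m.factorial : ℝ) * EW * EH / ((m : ℝ) - 1)) *
        Real.sqrt (∑ i, (α i - y i) ^ 2))
      - (m.factorial : ℝ) * ∑ i, α i * Real.log (α i)
    ≤ lpObj W H Y := by
  have : NeZero m := ⟨by omega⟩
  have hm' : (2 : ℝ) ≤ m := by exact_mod_cast hm
  have hYg : ∀ i g, Y i g = y (g⁻¹ i) := fun i g =>
    (congrFun (hY g) i).trans (permMat_mulVec g y i)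
  have hb : ∑ k, (α k - y k) = 0 := by
    rw [Finset.sum_sub_distrib, hα.2, hy.2, sub_self]
  have hcol : ∀ g : Equiv.Perm (Fin m),
      ∑ i, (W * H) i g * (α (g⁻¹ i) - y (g⁻¹ i)) - ∑ i, α i * Real.log (α i)
        ≤ crossEnt (softmax fun i => (W * H) i g) fun i => Y i g := fun g => by
    have h := le_crossEnt_softmax (a := fun i => α (g⁻¹ i)) (p := fun i => y (g⁻¹ i))
      (fun i => hαpos _) ((Equiv.sum_comp g⁻¹ α).trans hα.2)
      ((Equiv.sum_comp g⁻¹ y).trans hy.2) fun i => (W * H) i g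
    rw [Equiv.sum_comp g⁻¹ fun i => α i * Real.log (α i)] at h
    simpa only [hYg] using h
  have hsum := Finset.sum_le_sum fun g (_ : g ∈ Finset.univ) => hcol g
  rw [Finset.sum_sub_distrib, Finset.sum_const, Finset.card_univ, Fintype.card_perm,
    Fintype.card_fin, nsmul_eq_mul] at hsum
  have hCS := (abs_le.1 (abs_sum_mul_perm_le hm W H hb)).1
  have hle : √(m.factorial / ((m : ℝ) - 1) * (∑ k, (α k - y k) ^ 2) * frobSq W * frobSq H)
      ≤ √(m.factorial * EW * EH / ((m : ℝ) - 1)) * √(∑ k, (α k - y k) ^ 2) := by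
    have h1 : (0 : ℝ) ≤ m - 1 := by linarith
    have hH0 : 0 ≤ frobSq H :=
      Finset.sum_nonneg fun _ _ => Finset.sum_nonneg fun _ _ => sq_nonneg _
    rw [← Real.sqrt_mul (by positivity)]
    refine Real.sqrt_le_sqrt ?_
    calc _ ≤ m.factorial / ((m : ℝ) - 1) * (∑ k, (α k - y k) ^ 2) * EW * EH := by gcongr
      _ = _ := by ring
  unfold lpObj
  linarith
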